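/- Let n ≥ m ≥ 0 be integers, let κ be a nonzero real number and b a real number. Define c_0 = 1 and, for 1 ≤ j ≤ n − m, c_j = Π_{k=m}^{m+j−1} ( i(n − k)/(n + k + 1) ). Then ∫₀^b t^n e^{iκt} J_m(κt) dt = e^{iκb} b^{n+1} Σ_{j=m}^{n} ( c_{j−m}/(n + j + 1) ) · ( J_j(κb) − i J_{j+1}(κb) ). -/

import Mathlib

open Real MeasureTheory Complex

/-- Bessel function of the first kind of nonnegative integer order `m`. -/
noncomputable def besselJ (m : ℕ) (x : ℝ) : ℝ :=
  ∑' j : ℕ, ((-1 : ℝ) ^ j / ((j.factorial : ℝ) * ((j + m).factorial : ℝ))) * (x / 2) ^ (2 * j + m)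

/-- The coefficients of the Bessel–Clifford series `besselE`. -/
noncomputable def besselCoeff (m j : ℕ) : ℝ :=
  (-1 : ℝ) ^ j / ((j.factorial : ℝ) * ((j + m).factorial : ℝ))

/-- The entire function with `besselJ m x = (x / 2) ^ m * besselE m ((x / 2) ^ 2)`. -/
noncomputable def besselE (m : ℕ) (y : ℝ) : ℝ :=
  ∑' j : ℕ, besselCoeff m j * y ^ j

theorem abs_besselCoeff_le (m j : ℕ) : |besselCoeff m j| ≤ 1 / (j.factorial : ℝ) := by
  have h1 : (1 : ℝ) ≤ (j + m).factorial := by exact_mod_cast Nat.factorial_pos _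
  have h2 : (0 : ℝ) < j.factorial := by exact_mod_cast Nat.factorial_pos _
  rw [besselCoeff, abs_div, abs_pow, abs_neg, abs_one, one_pow, abs_of_pos (by positivity)]
  exact one_div_le_one_div_of_le h2 (le_mul_of_one_le_right h2.le h1)

theorem summable_besselCoeff (m : ℕ) (y : ℝ) : Summable fun j ↦ besselCoeff m j * y ^ j := by
  refine Summable.of_norm_bounded (Real.summable_pow_div_factorial |y|) fun j ↦ ?_
  rw [norm_mul, norm_pow, Real.norm_eq_abs, Real.norm_eq_abs, div_eq_mul_one_div, mul_comm]
  gcongr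
  exact abs_besselCoeff_le m j

theorem besselCoeff_succ (m j : ℕ) :
    besselCoeff m (j + 1) * (j + 1 : ℕ) = -besselCoeff (m + 1) j := by
  have h : j + 1 + m = j + (m + 1) := by ring
  have h0 : (j.factorial : ℝ) ≠ 0 := by positivity
  have h1 : ((j + (m + 1)).factorial : ℝ) ≠ 0 := by positivity
  have h2 : ((j : ℝ) + 1) ≠ 0 := by positivity
  simp only [besselCoeff, h, Nat.factorial_succ j]
  push_cast
  field_simp
  ring

theorem hasDerivAt_besselE (m : ℕ) (y : ℝ) :
    HasDerivAt (besselE m) (-besselE (m + 1) y) y := by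
  set R : ℝ := |y| + 1 with hR
  have hy : y ∈ Metric.ball (0 : ℝ) R := by simp [hR]
  have hu : Summable fun j : ℕ ↦ (j : ℝ) * R ^ (j - 1) / j.factorial := by
    rw [← summable_nat_add_iff 1]
    refine (Real.summable_pow_div_factorial R).congr fun j ↦ ?_
    have h0 : (j.factorial : ℝ) ≠ 0 := by positivity
    have h2 : ((j : ℝ) + 1) ≠ 0 := by positivity
    rw [Nat.factorial_succ, Nat.add_sub_cancel]
    push_cast
    field_simp
  have hbound : ∀ (j : ℕ) (z : ℝ), z ∈ Metric.ball (0 : ℝ) R →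
      ‖besselCoeff m j * ((j : ℝ) * z ^ (j - 1))‖ ≤ (j : ℝ) * R ^ (j - 1) / j.factorial := by
    intro j z hz
    have hz' : |z| ≤ R := by simpa using (mem_ball_zero_iff.mp hz).le
    rw [div_eq_mul_one_div, mul_comm _ (1 / (j.factorial : ℝ)), norm_mul, norm_mul, norm_pow,
      Real.norm_eq_abs, Real.norm_eq_abs, Real.norm_eq_abs, Nat.abs_cast]
    gcongr
    exact abs_besselCoeff_le m j
  have key := hasDerivAt_tsum_of_isPreconnected hu Metric.isOpen_ball
    (convex_ball (0 : ℝ) R).isPreconnected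
    (fun j z _ ↦ (hasDerivAt_pow j z).const_mul (besselCoeff m j)) hbound hy
    (summable_besselCoeff m y) hy
  refine key.congr_deriv ?_
  have hs : Summable fun j : ℕ ↦ besselCoeff m j * ((j : ℝ) * y ^ (j - 1)) :=
    Summable.of_norm_bounded hu fun j ↦ hbound j y hy
  rw [hs.tsum_eq_zero_add, besselE, ← tsum_neg]
  simp only [Nat.cast_zero, zero_mul, mul_zero, zero_add, Nat.add_sub_cancel, ← mul_assoc,
    besselCoeff_succ, neg_mul]

theorem besselE_recurrence (m : ℕ) (y : ℝ) :
    besselE m y = (m + 1) * besselE (m + 1) y - y * besselE (m + 2) y := by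
  have hs := summable_besselCoeff
  have h : ∀ j, besselCoeff m (j + 1) =
      (m + 1) * besselCoeff (m + 1) (j + 1) - besselCoeff (m + 2) j := by
    intro j
    have e1 : j + 1 + m = j + m + 1 := by ring
    have e2 : j + 1 + (m + 1) = j + m + 1 + 1 := by ring
    have e3 : j + (m + 2) = j + m + 1 + 1 := by ring
    have h0 : (j.factorial : ℝ) ≠ 0 := by positivity
    have h1 : ((j + m).factorial : ℝ) ≠ 0 := by positivity
    have h2 : ((j : ℝ) + 1) ≠ 0 := by positivity
    have h3 : ((j : ℝ) + m + 1) ≠ 0 := by positivity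
    have h4 : ((j : ℝ) + m + 1 + 1) ≠ 0 := by positivity
    simp only [besselCoeff, e1, e2, e3, Nat.factorial_succ]
    push_cast
    field_simp
    ring
  have h0 : besselCoeff m 0 = (m + 1) * besselCoeff (m + 1) 0 := by
    have h1 : (m.factorial : ℝ) ≠ 0 := by positivity
    have h2 : ((m : ℝ) + 1) ≠ 0 := by positivity
    simp only [besselCoeff, Nat.zero_add, Nat.factorial_succ]
    push_cast
    field_simp
  have hs1 := (summable_nat_add_iff 1).mpr (hs (m + 1) y)
  simp only [besselE]
  rw [(hs m y).tsum_eq_zero_add, (hs (m + 1) y).tsum_eq_zero_add, mul_add, ← tsum_mul_left,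
    ← tsum_mul_left, add_sub_assoc, ← (hs1.mul_left _).tsum_sub ((hs (m + 2) y).mul_left _), h0]
  congr 1
  · ring
  · refine tsum_congr fun j ↦ ?_
    rw [h]
    ring

theorem besselJ_eq (m : ℕ) (x : ℝ) : besselJ m x = (x / 2) ^ m * besselE m ((x / 2) ^ 2) := by
  rw [besselJ, besselE, ← tsum_mul_left]
  refine tsum_congr fun j ↦ ?_
  rw [besselCoeff, pow_add, pow_mul]
  ring

theorem differentiable_besselJ (m : ℕ) : Differentiable ℝ (besselJ m) := by
  have hE : Differentiable ℝ (besselE m) := fun y ↦ (hasDerivAt_besselE m y).differentiableAt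
  rw [funext (besselJ_eq m)]
  fun_prop

theorem mul_deriv_besselJ (m : ℕ) (x : ℝ) :
    x * deriv (besselJ m) x = m * besselJ m x - x * besselJ (m + 1) x := by
  have h2 : HasDerivAt (fun x : ℝ ↦ x / 2) (1 / 2) x := (hasDerivAt_id x).div_const 2
  have hd := (h2.pow m).mul ((hasDerivAt_besselE m ((x / 2) ^ 2)).comp x (h2.pow 2))
  have hJ : besselJ m = (fun x : ℝ ↦ x / 2) ^ m * (besselE m ∘ ((fun x : ℝ ↦ x / 2) ^ 2)) :=
    funext (besselJ_eq m)
  rw [hJ, hd.deriv, ← hJ, besselJ_eq, besselJ_eq]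
  rcases m with _ | m
  · simp only [Nat.cast_zero, pow_zero, Pi.one_apply]
    push_cast
    ring
  · simp only [Function.comp_apply, Pi.pow_apply, Nat.add_sub_cancel]
    push_cast
    ring

theorem besselJ_recurrence (m : ℕ) (x : ℝ) :
    x * besselJ m x + x * besselJ (m + 2) x = 2 * (m + 1) * besselJ (m + 1) x := by
  rw [besselJ_eq, besselJ_eq, besselJ_eq, besselE_recurrence]
  ring

theorem mul_deriv_besselJ_succ (m : ℕ) (x : ℝ) :
    x * deriv (besselJ (m + 1)) x = x * besselJ m x - (m + 1) * besselJ (m + 1) x := by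
  have h := besselJ_recurrence m x
  have h' := mul_deriv_besselJ (m + 1) x
  push_cast at h'
  linarith

/-- The integrand `t ^ n * exp (i κ t) * J_j (κ t)`. -/
noncomputable def expBessel (n : ℕ) (κ : ℝ) (j : ℕ) (t : ℝ) : ℂ :=
  (t : ℂ) ^ n * Complex.exp (Complex.I * κ * t) * (besselJ j (κ * t) : ℂ)

theorem continuous_expBessel (n : ℕ) (κ : ℝ) (j : ℕ) : Continuous (expBessel n κ j) := by
  have := (differentiable_besselJ j).continuous
  unfold expBessel
  fun_prop

theorem hasDerivAt_besselJ_comp_mul (κ : ℝ) (j : ℕ) (t : ℝ) :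
    HasDerivAt (fun t : ℝ ↦ (besselJ j (κ * t) : ℂ)) ((κ * deriv (besselJ j) (κ * t) : ℝ) : ℂ) t := by
  have h : HasDerivAt (fun t : ℝ ↦ κ * t) κ t := by simpa using (hasDerivAt_id t).const_mul κ
  have := ((differentiable_besselJ j (κ * t)).hasDerivAt.comp t h).ofReal_comp
  rwa [mul_comm] at this

theorem hasDerivAt_exp_mul_besselJ_sub (n : ℕ) (κ : ℝ) (j : ℕ) (t : ℝ) :
    HasDerivAt (fun t : ℝ ↦ Complex.exp (Complex.I * κ * t) * (t : ℂ) ^ (n + 1) *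
        ((besselJ j (κ * t) : ℂ) - Complex.I * (besselJ (j + 1) (κ * t) : ℂ)))
      (((n : ℂ) + j + 1) * expBessel n κ j t -
        Complex.I * ((n : ℂ) - j) * expBessel n κ (j + 1) t) t := by
  have hid : HasDerivAt (fun t : ℝ ↦ (t : ℂ)) 1 t := (hasDerivAt_id t).ofReal_comp
  have hexp := (hid.const_mul (Complex.I * κ)).cexp
  have hJ := (hasDerivAt_besselJ_comp_mul κ j t).sub
    ((hasDerivAt_besselJ_comp_mul κ (j + 1) t).const_mul Complex.I)
  have h1 := congrArg (fun r : ℝ ↦ (r : ℂ)) (mul_deriv_besselJ j (κ * t))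
  have h2 := congrArg (fun r : ℝ ↦ (r : ℂ)) (mul_deriv_besselJ_succ j (κ * t))
  refine ((hexp.mul (hid.pow (n + 1))).mul hJ).congr_deriv ?_
  push_cast at h1 h2
  simp only [expBessel, Pi.mul_apply, Pi.pow_apply, Pi.sub_apply, Nat.add_sub_cancel]
  push_cast
  linear_combination (-Complex.exp (Complex.I * κ * t) * (t : ℂ) ^ n) * (-h1 + Complex.I * h2) -
    Complex.exp (Complex.I * κ * t) * (t : ℂ) ^ (n + 1) * κ * besselJ (j + 1) (κ * t) * Complex.I_sq

theorem integral_expBessel (n : ℕ) (κ b : ℝ) (j : ℕ) :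
    ∫ t in (0 : ℝ)..b, expBessel n κ j t =
      Complex.exp (Complex.I * κ * b) * (b : ℂ) ^ (n + 1) / ((n : ℂ) + j + 1) *
        ((besselJ j (κ * b) : ℂ) - Complex.I * (besselJ (j + 1) (κ * b) : ℂ)) +
      Complex.I * ((n : ℂ) - j) / ((n : ℂ) + j + 1) *
        ∫ t in (0 : ℝ)..b, expBessel n κ (j + 1) t := by
  have hi : ∀ (k : ℕ) (a : ℂ), IntervalIntegrable (fun t ↦ a * expBessel n κ k t) volume 0 b :=
    fun k a ↦ ((continuous_expBessel n κ k).const_mul a).intervalIntegrable 0 b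
  have h := intervalIntegral.integral_eq_sub_of_hasDerivAt
    (fun t _ ↦ hasDerivAt_exp_mul_besselJ_sub n κ j t) ((hi j _).sub (hi (j + 1) _))
  rw [intervalIntegral.integral_sub (hi j _) (hi (j + 1) _),
    intervalIntegral.integral_const_mul, intervalIntegral.integral_const_mul] at h
  have h0 : ((n : ℂ) + j + 1) ≠ 0 := by exact_mod_cast (n + j).succ_ne_zero
  simp only [Complex.ofReal_zero, zero_pow n.succ_ne_zero, mul_zero, zero_mul, sub_zero] at h
  field_simp
  linear_combination h

theorem stmt_18 (n m : ℕ) (hnm : m ≤ n) (κ b : ℝ) (hκ : κ ≠ 0) (c : ℕ → ℂ)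
    (hc : ∀ j : ℕ, c j =
      ∏ k ∈ Finset.range j,
        (Complex.I * ((n : ℂ) - (m + k : ℕ)) / ((n : ℂ) + (m + k : ℕ) + 1))) :
    ∫ t in (0:ℝ)..b, (t : ℂ) ^ n * Complex.exp (Complex.I * κ * t) * (besselJ m (κ * t) : ℂ) =
      Complex.exp (Complex.I * κ * b) * (b : ℂ) ^ (n + 1) *
        ∑ j ∈ Finset.Icc m n, (c (j - m) / ((n : ℂ) + j + 1)) *
          ((besselJ j (κ * b) : ℂ) - Complex.I * (besselJ (j + 1) (κ * b) : ℂ)) := by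
  have h_sum : ∀ N : ℕ, ∫ t in (0 : ℝ)..b, expBessel n κ m t =
      Complex.exp (Complex.I * κ * b) * (b : ℂ) ^ (n + 1) *
        ∑ k ∈ Finset.range N, (c k / ((n : ℂ) + (m + k : ℕ) + 1)) *
          ((besselJ (m + k) (κ * b) : ℂ) - Complex.I * (besselJ (m + k + 1) (κ * b) : ℂ)) +
      c N * ∫ t in (0 : ℝ)..b, expBessel n κ (m + N) t := by
    intro N
    induction N with
    | zero => simp [hc 0]
    | succ N ih =>
      have hcN : c (N + 1) =
          c N * (Complex.I * ((n : ℂ) - (m + N : ℕ)) / ((n : ℂ) + (m + N : ℕ) + 1)) := by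
        rw [hc, hc, Finset.prod_range_succ]
      rw [ih, integral_expBessel n κ b (m + N), Finset.sum_range_succ, hcN, ← add_assoc m N 1]
      ring
  have hzero : c (n + 1 - m) = 0 := by
    rw [hc]
    refine Finset.prod_eq_zero (i := n - m) (Finset.mem_range.mpr (by omega)) ?_
    rw [Nat.add_sub_cancel' hnm]
    simp
  have h := h_sum (n + 1 - m)
  rw [hzero, zero_mul, add_zero] at h
  rw [← Finset.Ico_add_one_right_eq_Icc, Finset.sum_Ico_eq_sum_range]
  simpa only [Nat.add_sub_cancel_left, expBessel] using h
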